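/- Let \mu be a Radon measure on B_1 = [-1,1]^d with \mu(A) > 0 for a Borel set A. Then for \mu-almost all x \in A, the set of micromeasure distributions of \mu at x coincides with the set of micromeasure distributions of the normalized restriction \mu_A at x: \mathcal{MD}(\mu,x) = \mathcal{MD}(\mu_A, x). -/

import Mathlib

open MeasureTheory Filter Topology

/-- `B₁ = [-1,1]^d`. -/
abbrev UnitCube (d : ℕ) : Set (Fin d → ℝ) := Set.Icc (fun _ => (-1:ℝ)) (fun _ => (1:ℝ))

noncomputable instance (d : ℕ) : MeasurableSpace (ProbabilityMeasure (UnitCube d)) := borel _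
instance (d : ℕ) : BorelSpace (ProbabilityMeasure (UnitCube d)) := ⟨rfl⟩

/-- `Ξ = 𝒫(B₁) × B₁`. -/
abbrev Xi (d : ℕ) := ProbabilityMeasure (UnitCube d) × UnitCube d

/-- The homothety mapping the first-level dyadic cube containing a point of `B₁`
onto `B₁` (applied coordinatewise). -/
noncomputable def cubeExpand (d : ℕ) (x : UnitCube d) : UnitCube d :=
  ⟨fun i => if (x : Fin d → ℝ) i < 0 then 2 * (x : Fin d → ℝ) i + 1
            else 2 * (x : Fin d → ℝ) i - 1, by
    obtain ⟨h₁, h₂⟩ := x.2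
    refine ⟨fun i => ?_, fun i => ?_⟩ <;>
      · have a := h₁ i
        have b := h₂ i
        simp only at a b ⊢
        split_ifs <;> linarith⟩

/-- The first-level dyadic cube of `B₁` containing `x` (as a subset of `B₁`). -/
def cubeOf (d : ℕ) (x : UnitCube d) : Set (UnitCube d) :=
  {y | ∀ i, ((y : Fin d → ℝ) i < 0 ↔ (x : Fin d → ℝ) i < 0)}

open scoped Classical in
/-- The dyadic magnification operator `M(μ,x) = (T_{D(x)}^□ μ, T_{D(x)} x)` on
`Ξ = 𝒫(B₁) × B₁`: the measure component is the normalized pushforward of `μ`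
restricted to the first-level dyadic cube `D(x)` containing `x`, rescaled to `B₁`
(with a junk value when the normalization is undefined). -/
noncomputable def magnify (d : ℕ) (p : Xi d) : Xi d :=
  if h : IsProbabilityMeasure
      ((((p.1 : Measure (UnitCube d)) (cubeOf d p.2))⁻¹ •
        ((p.1 : Measure (UnitCube d)).restrict (cubeOf d p.2)).map (cubeExpand d))) then
    (⟨_, h⟩, cubeExpand d p.2)
  else (p.1, cubeExpand d p.2)

/-- Adaptedness: `∫ f(ν,x) dQ(ν,x) = ∫∫ f(ν,x) dν(x) dQ̄(ν)` for all continuous `f`. -/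
def Adapted (d : ℕ) (Q : Measure (Xi d)) : Prop :=
  ∀ f : C(Xi d, ℝ),
    (∫ p, f p ∂Q) =
      ∫ ν, (∫ x, f (ν, x) ∂(ν : Measure (UnitCube d))) ∂(Q.map Prod.fst)

/-- Normalized Lebesgue measure on `B₁`. -/
noncomputable def normLeb (d : ℕ) : Measure (UnitCube d) :=
  ((2 : ENNReal) ^ d)⁻¹ • (volume : Measure (Fin d → ℝ)).comap Subtype.val

/-- The intensity measure `[Q](A) = ∫ μ(A) dQ̄(μ)` equals normalized Lebesgue measure. -/
def HasLebesgueIntensity (d : ℕ) (Q : Measure (Xi d)) : Prop :=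
  ∀ A : Set (UnitCube d), MeasurableSet A →
    (∫⁻ ν, (ν : Measure (UnitCube d)) A ∂(Q.map Prod.fst)) = normLeb d A

/-- A CP distribution: an `M`-invariant, adapted probability distribution on `Ξ`
with normalized-Lebesgue intensity. -/
def IsCPD (d : ℕ) (Q : Measure (Xi d)) : Prop :=
  IsProbabilityMeasure Q ∧ MeasurePreserving (magnify d) Q Q ∧
    Adapted d Q ∧ HasLebesgueIntensity d Q

instance (d : ℕ) : Nonempty (UnitCube d) :=
  ⟨⟨fun _ => 0, ⟨fun _ => by norm_num, fun _ => by norm_num⟩⟩⟩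

open scoped Classical in
/-- The normalization `μ ↦ μ/μ(B₁)` of a measure on `B₁` as a probability measure
(with a junk value when this is not defined). -/
noncomputable def normPM (d : ℕ) (μ : Measure (UnitCube d)) :
    ProbabilityMeasure (UnitCube d) :=
  if h : IsProbabilityMeasure ((μ Set.univ)⁻¹ • μ) then ⟨_, h⟩
  else ⟨Measure.dirac (Classical.arbitrary _), inferInstance⟩

open scoped Classical in
/-- The CP scenery distribution `⟨μ,x⟩_N = N⁻¹ ∑_{k<N} δ_{M^k(μ,x)}` of a point
`(μ,x) ∈ Ξ` along the first `N` dyadic scales (junk value for `N = 0`). -/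
noncomputable def cpScenery (d : ℕ) (p : Xi d) (N : ℕ) : ProbabilityMeasure (Xi d) :=
  if hN : N = 0 then ⟨Measure.dirac p, inferInstance⟩
  else
    ⟨(N : ENNReal)⁻¹ • ∑ k ∈ Finset.range N, Measure.dirac ((magnify d)^[k] p), by
      constructor
      simp only [Measure.smul_apply, Measure.finset_sum_apply, measure_univ,
        Finset.sum_const, Finset.card_range, nsmul_eq_mul, mul_one, smul_eq_mul]
      exact ENNReal.inv_mul_cancel (by exact_mod_cast hN) (ENNReal.natCast_ne_top N)⟩

/-- The set of micromeasure distributions of `μ` at `x`: all weak accumulation points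
of the CP scenery distributions `⟨μ^□, x⟩_N` as `N → ∞`. -/
def MD (d : ℕ) (μ : Measure (UnitCube d)) (x : UnitCube d) :
    Set (ProbabilityMeasure (Xi d)) :=
  {Q | MapClusterPt Q atTop (cpScenery d (normPM d μ, x))}

/-- Coordinatewise signs of a point of the cube. -/
noncomputable def sgnCode (d : ℕ) (x : UnitCube d) : Fin d → Bool :=
  fun i => decide ((x : Fin d → ℝ) i < 0)

/-- First `k` dyadic digits. -/
noncomputable def dyCode (d : ℕ) (k : ℕ) (x : UnitCube d) : Fin k → Fin d → Bool :=
  fun j => sgnCode d ((cubeExpand d)^[j] x)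

/-- Level-`k` dyadic cube containing `x`. -/
def dyCube (d : ℕ) (k : ℕ) (x : UnitCube d) : Set (UnitCube d) :=
  {y | ∀ j < k, (cubeExpand d)^[j] y ∈ cubeOf d ((cubeExpand d)^[j] x)}

lemma measurable_cubeExpand (d : ℕ) : Measurable (cubeExpand d) := by
  unfold cubeExpand
  refine Measurable.subtype_mk (measurable_pi_lambda _ fun i => ?_)
  have h : Measurable fun x : UnitCube d => (x : Fin d → ℝ) i :=
    (measurable_pi_apply i).comp measurable_subtype_coe
  exact Measurable.ite (measurableSet_lt h measurable_const) ((h.const_mul 2).add_const 1)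
    ((h.const_mul 2).sub_const 1)

lemma measurable_sgnCode (d : ℕ) : Measurable (sgnCode d) := by
  refine measurable_pi_lambda _ fun i => ?_
  have h : Measurable fun x : UnitCube d => (x : Fin d → ℝ) i :=
    (measurable_pi_apply i).comp measurable_subtype_coe
  refine measurable_to_bool ?_
  have : (fun x : UnitCube d => sgnCode d x i) ⁻¹' {true}
      = {x : UnitCube d | (x : Fin d → ℝ) i < 0} := by
    ext x; simp [sgnCode]
  rw [this]
  exact measurableSet_lt h measurable_const

lemma mem_cubeOf_iff (d : ℕ) (x y : UnitCube d) : y ∈ cubeOf d x ↔ sgnCode d y = sgnCode d x := by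
  simp [cubeOf, sgnCode, funext_iff]

lemma measurable_dyCode (d k : ℕ) : Measurable (dyCode d k) :=
  measurable_pi_lambda _ fun j =>
    (measurable_sgnCode d).comp ((measurable_cubeExpand d).iterate j)

lemma dyCube_eq (d k : ℕ) (x : UnitCube d) : dyCube d k x = dyCode d k ⁻¹' {dyCode d k x} := by
  ext y
  simp only [dyCube, Set.mem_setOf_eq, mem_cubeOf_iff, Set.mem_preimage, Set.mem_singleton_iff,
    funext_iff (f := dyCode d k y), dyCode]
  exact ⟨fun h j => h j j.2, fun h j hj => h ⟨j, hj⟩⟩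

lemma measurableSet_cubeOf (d : ℕ) (x : UnitCube d) : MeasurableSet (cubeOf d x) := by
  have : cubeOf d x = sgnCode d ⁻¹' {sgnCode d x} := by
    ext y; simp [mem_cubeOf_iff]
  rw [this]
  exact measurable_sgnCode d (MeasurableSet.singleton _)

lemma measurableSet_dyCube (d k : ℕ) (x : UnitCube d) : MeasurableSet (dyCube d k x) := by
  rw [dyCube_eq]
  exact measurable_dyCode d k (MeasurableSet.singleton _)

lemma dyCube_succ (d k : ℕ) (x : UnitCube d) :
    dyCube d (k+1) x = dyCube d k x ∩ (cubeExpand d)^[k] ⁻¹' cubeOf d ((cubeExpand d)^[k] x) := by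
  ext y
  simp only [dyCube, Set.mem_setOf_eq, Set.mem_inter_iff, Set.mem_preimage]
  constructor
  · exact fun h => ⟨fun j hj => h j (by omega), h k (by omega)⟩
  · rintro ⟨h1, h2⟩ j hj
    rcases Nat.lt_succ_iff_lt_or_eq.1 hj with h | h
    · exact h1 j h
    · exact h ▸ h2

lemma dist_expand (d : ℕ) (x y : UnitCube d) (h : sgnCode d x = sgnCode d y) (i : Fin d) :
    (cubeExpand d x : Fin d → ℝ) i - (cubeExpand d y : Fin d → ℝ) i
      = 2 * ((x : Fin d → ℝ) i - (y : Fin d → ℝ) i) := by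
  have := congrFun h i
  simp only [sgnCode, decide_eq_decide] at this
  simp only [cubeExpand, this]
  split_ifs <;> ring

lemma dist_expand_iter (d : ℕ) (x y : UnitCube d)
    (h : ∀ j, sgnCode d ((cubeExpand d)^[j] x) = sgnCode d ((cubeExpand d)^[j] y))
    (k : ℕ) (i : Fin d) :
    ((cubeExpand d)^[k] x : Fin d → ℝ) i - ((cubeExpand d)^[k] y : Fin d → ℝ) i
      = 2 ^ k * ((x : Fin d → ℝ) i - (y : Fin d → ℝ) i) := by
  induction k with
  | zero => simp
  | succ k ih =>
    rw [Function.iterate_succ_apply', Function.iterate_succ_apply', dist_expand d _ _ (h k), ih]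
    ring

/-- The full dyadic code. -/
noncomputable def fullCode (d : ℕ) (x : UnitCube d) : ℕ → Fin d → Bool :=
  fun j => sgnCode d ((cubeExpand d)^[j] x)

lemma fullCode_injective (d : ℕ) : Function.Injective (fullCode d) := by
  intro x y hxy
  have h := dist_expand_iter d x y (fun j => congrFun hxy j)
  apply Subtype.ext
  funext i
  by_contra hne
  set δ := |(x : Fin d → ℝ) i - (y : Fin d → ℝ) i| with hδ
  have hpos : 0 < δ := abs_pos.2 (sub_ne_zero.2 hne)
  obtain ⟨k, hk⟩ := pow_unbounded_of_one_lt (2 / δ) (one_lt_two (α := ℝ))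
  have h1 := h k i
  have a := ((cubeExpand d)^[k] x).2
  have b := ((cubeExpand d)^[k] y).2
  have h2 : |((cubeExpand d)^[k] x : Fin d → ℝ) i - ((cubeExpand d)^[k] y : Fin d → ℝ) i| ≤ 2 := by
    have a1 := a.1 i
    have a2 := a.2 i
    have b1 := b.1 i
    have b2 := b.2 i
    simp only at a1 a2 b1 b2
    rw [abs_le]; constructor <;> linarith
  rw [h1, abs_mul, abs_of_pos (by positivity : (0:ℝ) < 2 ^ k), ← hδ] at h2
  rw [div_lt_iff₀ hpos] at hk
  linarith

lemma fullCode_embedding (d : ℕ) : MeasurableEmbedding (fullCode d) :=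
  Measurable.measurableEmbedding (measurable_pi_lambda _ fun j =>
    (measurable_sgnCode d).comp ((measurable_cubeExpand d).iterate j)) (fullCode_injective d)

/-- The dyadic filtration. -/
noncomputable def dyFilt (d : ℕ) : Filtration ℕ (inferInstance : MeasurableSpace (UnitCube d)) where
  seq k := MeasurableSpace.comap (dyCode d k) inferInstance
  mono' := by
    intro k l hkl
    have : dyCode d k = (fun c : Fin l → Fin d → Bool => fun j : Fin k => c (Fin.castLE hkl j)) ∘
        dyCode d l := by
      funext x j; rfl
    simp only
    rw [this, ← MeasurableSpace.comap_comp]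
    exact MeasurableSpace.comap_mono (Measurable.comap_le (by fun_prop))
  le' k := (measurable_dyCode d k).comap_le

lemma le_iSup_dyFilt (d : ℕ) :
    (inferInstance : MeasurableSpace (UnitCube d)) ≤ ⨆ n, dyFilt d n := by
  have h := (fullCode_embedding d).comap_eq
  refine h.symm.le.trans ?_
  apply Measurable.comap_le
  refine @measurable_pi_lambda _ _ _ (⨆ n, (dyFilt d n : MeasurableSpace _)) _ _ fun j => ?_
  have h1 : Measurable[dyFilt d (j+1)] (fun x => fullCode d x j) := by
    have : (fun x => fullCode d x j) = (fun c : Fin (j+1) → Fin d → Bool => c (Fin.last j)) ∘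
        dyCode d (j+1) := by
      funext x; simp [fullCode, dyCode]
    rw [this]
    exact (measurable_pi_apply _).comp (comap_measurable _)
  exact h1.mono (le_iSup (fun n => (dyFilt d n : MeasurableSpace _)) (j+1)) le_rfl

lemma condExp_dy (d : ℕ) (μ : Measure (UnitCube d)) [IsFiniteMeasure μ]
    (A : Set (UnitCube d)) (hA : MeasurableSet A) (k : ℕ) (x : UnitCube d) :
    μ.real (dyCube d k x) * (μ[A.indicator (fun _ => (1:ℝ)) | dyFilt d k]) x
      = μ.real (dyCube d k x ∩ A) := by
  have hint : Integrable (A.indicator (fun _ => (1:ℝ))) μ := (integrable_const _).indicator hA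
  have hm : MeasurableSet[dyFilt d k] (dyCube d k x) := by
    rw [dyCube_eq]
    exact ⟨_, MeasurableSet.singleton _, rfl⟩
  have h1 := setIntegral_condExp ((dyFilt d).le k) hint hm
  have hsm : Measurable[dyFilt d k] (μ[A.indicator (fun _ => (1:ℝ)) | dyFilt d k]) :=
    stronglyMeasurable_condExp.measurable
  have hconst : ∀ y ∈ dyCube d k x, (μ[A.indicator (fun _ => (1:ℝ)) | dyFilt d k]) y
      = (μ[A.indicator (fun _ => (1:ℝ)) | dyFilt d k]) x := by
    intro y hy
    obtain ⟨s, -, hs⟩ := hsm (MeasurableSet.singleton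
      ((μ[A.indicator (fun _ => (1:ℝ)) | dyFilt d k]) x))
    have hx : x ∈ dyCode d k ⁻¹' s := by rw [hs]; simp
    rw [dyCube_eq] at hy
    have : y ∈ dyCode d k ⁻¹' s := by
      have hy' : dyCode d k y = dyCode d k x := hy
      simpa [hy'] using hx
    rw [hs] at this
    exact this
  rw [setIntegral_congr_fun (measurableSet_dyCube d k x) hconst, setIntegral_const,
    setIntegral_indicator hA, setIntegral_const] at h1
  simpa using h1

lemma ae_pos (d : ℕ) (ν : Measure (UnitCube d)) :
    ∀ᵐ x ∂ν, ∀ k, ν (dyCube d k x) ≠ 0 := by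
  rw [ae_all_iff]
  intro k
  rw [ae_iff]
  have : {x | ¬ ν (dyCube d k x) ≠ 0} ⊆
      ⋃ c : {c : Fin k → Fin d → Bool // ν (dyCode d k ⁻¹' {c}) = 0}, dyCode d k ⁻¹' {c.1} := by
    intro x hx
    simp only [not_not, Set.mem_setOf_eq, dyCube_eq] at hx
    exact Set.mem_iUnion.2 ⟨⟨_, hx⟩, rfl⟩
  exact measure_mono_null this (measure_iUnion_null fun c => c.2)

lemma ae_density (d : ℕ) (μ : Measure (UnitCube d)) [IsFiniteMeasure μ]
    (A : Set (UnitCube d)) (hA : MeasurableSet A) :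
    ∀ᵐ x ∂(μ.restrict A), (∀ k, μ (dyCube d k x ∩ A) ≠ 0) ∧
      Tendsto (fun k => μ.real (dyCube d k x ∩ A) / μ.real (dyCube d k x)) atTop (𝓝 1) := by
  have h1 := ae_pos d (μ.restrict A)
  have hint : Integrable (A.indicator (fun _ => (1:ℝ))) μ := (integrable_const _).indicator hA
  have h2 := hint.tendsto_ae_condExp (ℱ := dyFilt d) (by
    refine StronglyMeasurable.mono ?_ (le_iSup_dyFilt d)
    exact stronglyMeasurable_const.indicator hA)
  have h2' := ae_restrict_of_ae (s := A) h2
  filter_upwards [h1, h2', ae_restrict_mem hA] with x hx hx2 hxA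
  have hp : ∀ k, μ (dyCube d k x ∩ A) ≠ 0 := by
    intro k
    have := hx k
    rwa [Measure.restrict_apply (measurableSet_dyCube d k x)] at this
  refine ⟨hp, ?_⟩
  simp only [Set.indicator_of_mem hxA] at hx2
  refine hx2.congr fun k => ?_
  rw [← condExp_dy d μ A hA k x, mul_div_cancel_left₀]
  rw [measureReal_def, ENNReal.toReal_ne_zero]
  exact ⟨fun h => hp k (measure_mono_null Set.inter_subset_left h), measure_ne_top _ _⟩

lemma magnify_iter (d : ℕ) (μ : Measure (UnitCube d)) [IsFiniteMeasure μ] (x : UnitCube d)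
    (h : ∀ k, μ (dyCube d k x) ≠ 0) (k : ℕ) :
    (((magnify d)^[k] (normPM d μ, x)).1 : Measure (UnitCube d))
        = (μ (dyCube d k x))⁻¹ • (μ.restrict (dyCube d k x)).map (cubeExpand d)^[k] ∧
      ((magnify d)^[k] (normPM d μ, x)).2 = (cubeExpand d)^[k] x := by
  induction k with
  | zero =>
    have h0 : dyCube d 0 x = Set.univ := by ext; simp [dyCube]
    have hu : μ Set.univ ≠ 0 := h0 ▸ h 0
    have hp : IsProbabilityMeasure ((μ Set.univ)⁻¹ • μ) :=
      ⟨by simp [ENNReal.inv_mul_cancel hu (measure_ne_top _ _)]⟩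
    simp [h0, normPM, hp]
  | succ k ih =>
    rw [Function.iterate_succ_apply', Function.iterate_succ_apply']
    generalize (magnify d)^[k] (normPM d μ, x) = p at ih ⊢
    obtain ⟨ih1, ih2⟩ := ih
    have hT := (measurable_cubeExpand d).iterate k
    have hC := measurableSet_cubeOf d ((cubeExpand d)^[k] x)
    have key : (((p.1 : Measure (UnitCube d)) (cubeOf d p.2))⁻¹ •
        ((p.1 : Measure (UnitCube d)).restrict (cubeOf d p.2)).map (cubeExpand d))
        = (μ (dyCube d (k+1) x))⁻¹ •
          (μ.restrict (dyCube d (k+1) x)).map (cubeExpand d)^[k+1] := by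
      rw [ih1, ih2, Measure.restrict_smul, Measure.restrict_map hT hC, Measure.map_smul,
        Measure.map_map (measurable_cubeExpand d) hT, Measure.smul_apply,
        Measure.map_apply hT hC, Measure.restrict_apply (hT hC),
        Measure.restrict_restrict (hT hC), Set.inter_comm, ← dyCube_succ,
        ← Function.iterate_succ', smul_smul, smul_eq_mul]
      congr 1
      have a := h k
      have b : μ (dyCube d k x) ≠ ⊤ := measure_ne_top _ _
      rw [ENNReal.mul_inv (Or.inl (ENNReal.inv_ne_zero.2 b)) (Or.inl (ENNReal.inv_ne_top.2 a)),
        inv_inv, mul_right_comm, ENNReal.mul_inv_cancel a b, one_mul]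
    have hp : IsProbabilityMeasure (((p.1 : Measure (UnitCube d)) (cubeOf d p.2))⁻¹ •
        ((p.1 : Measure (UnitCube d)).restrict (cubeOf d p.2)).map (cubeExpand d)) := by
      rw [key]
      constructor
      rw [Measure.smul_apply, Measure.map_apply ((measurable_cubeExpand d).iterate _) .univ]
      simp [ENNReal.inv_mul_cancel (h (k+1)) (measure_ne_top _ _)]
    rw [magnify, dif_pos hp]
    exact ⟨key, congrArg (cubeExpand d) ih2⟩

lemma integral_magnify (d : ℕ) (μ : Measure (UnitCube d)) [IsFiniteMeasure μ] (x : UnitCube d)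
    (h : ∀ k, μ (dyCube d k x) ≠ 0) (k : ℕ) (g : BoundedContinuousFunction (UnitCube d) ℝ) :
    ∫ y, g y ∂(((magnify d)^[k] (normPM d μ, x)).1 : Measure (UnitCube d))
      = (μ.real (dyCube d k x))⁻¹ * ∫ y in dyCube d k x, g ((cubeExpand d)^[k] y) ∂μ := by
  rw [(magnify_iter d μ x h k).1, integral_smul_measure,
    integral_map ((measurable_cubeExpand d).iterate k).aemeasurable
      g.continuous.aestronglyMeasurable]
  simp [measureReal_def]

lemma integral_close (d : ℕ) (μ : Measure (UnitCube d)) [IsFiniteMeasure μ]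
    (A : Set (UnitCube d)) (hA : MeasurableSet A) (x : UnitCube d)
    (h : ∀ k, μ (dyCube d k x ∩ A) ≠ 0) (k : ℕ) (g : BoundedContinuousFunction (UnitCube d) ℝ) :
    |∫ y, g y ∂(((magnify d)^[k] (normPM d μ, x)).1 : Measure (UnitCube d))
      - ∫ y, g y ∂(((magnify d)^[k] (normPM d (μ.restrict A), x)).1 : Measure (UnitCube d))|
      ≤ 2 * ‖g‖ * (1 - μ.real (dyCube d k x ∩ A) / μ.real (dyCube d k x)) := by
  have hD := measurableSet_dyCube d k x
  rw [integral_magnify d μ x (fun k hk => h k (measure_mono_null Set.inter_subset_left hk)),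
    integral_magnify d (μ.restrict A) x (fun k => by
      rw [Measure.restrict_apply (measurableSet_dyCube d k x)]; exact h k)]
  rw [measureReal_restrict_apply hD, Measure.restrict_restrict hD]
  have hgi : Integrable (fun y => g ((cubeExpand d)^[k] y)) μ := by
    refine Integrable.of_bound (C := ‖g‖) ?_ (ae_of_all _ fun y => g.norm_coe_le_norm _)
    exact (g.continuous.measurable.comp
      ((measurable_cubeExpand d).iterate k)).aestronglyMeasurable
  rw [← integral_inter_add_diff hA hgi.integrableOn]
  have e1 : ‖∫ y in dyCube d k x ∩ A, g ((cubeExpand d)^[k] y) ∂μ‖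
      ≤ ‖g‖ * μ.real (dyCube d k x ∩ A) :=
    norm_setIntegral_le_of_norm_le_const (measure_lt_top _ _) fun y _ => g.norm_coe_le_norm _
  have e2 : ‖∫ y in dyCube d k x \ A, g ((cubeExpand d)^[k] y) ∂μ‖
      ≤ ‖g‖ * μ.real (dyCube d k x \ A) :=
    norm_setIntegral_le_of_norm_le_const (measure_lt_top _ _) fun y _ => g.norm_coe_le_norm _
  have e3 : μ.real (dyCube d k x ∩ A) + μ.real (dyCube d k x \ A) = μ.real (dyCube d k x) :=
    measureReal_inter_add_diff hA
  have hpos : 0 < μ.real (dyCube d k x ∩ A) :=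
    ENNReal.toReal_pos (h k) (measure_ne_top _ _)
  have hnn : 0 ≤ μ.real (dyCube d k x \ A) := measureReal_nonneg
  rw [← e3]
  generalize μ.real (dyCube d k x ∩ A) = a at *
  generalize μ.real (dyCube d k x \ A) = b at *
  generalize (∫ y in dyCube d k x ∩ A, g ((cubeExpand d)^[k] y) ∂μ) = I at *
  generalize (∫ y in dyCube d k x \ A, g ((cubeExpand d)^[k] y) ∂μ) = J at *
  rw [Real.norm_eq_abs] at e1 e2
  have hab : 0 < a + b := by linarith
  have r1 : (a + b)⁻¹ * (I + J) - a⁻¹ * I = (a + b)⁻¹ * (J - (b / a) * I) := by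
    field_simp; ring
  have r2 : 2 * ‖g‖ * (1 - a / (a + b)) = (a + b)⁻¹ * (‖g‖ * b + (b / a) * (‖g‖ * a)) := by
    field_simp; ring
  rw [r1, r2, abs_mul, abs_of_pos (inv_pos.2 hab)]
  refine mul_le_mul_of_nonneg_left ?_ (inv_pos.2 hab).le
  refine (abs_sub _ _).trans (add_le_add e2 ?_)
  rw [abs_mul, abs_of_nonneg (by positivity : 0 ≤ b / a)]
  exact mul_le_mul_of_nonneg_left e1 (by positivity)

lemma integral_cpScenery (d : ℕ) (p : Xi d) (N : ℕ) (hN : N ≠ 0)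
    (f : BoundedContinuousFunction (Xi d) ℝ) :
    ∫ q, f q ∂(cpScenery d p N : Measure (Xi d))
      = (N : ℝ)⁻¹ * ∑ k ∈ Finset.range N, f ((magnify d)^[k] p) := by
  have : (cpScenery d p N : Measure (Xi d))
      = (N : ENNReal)⁻¹ • ∑ k ∈ Finset.range N, Measure.dirac ((magnify d)^[k] p) := by
    exact congrArg Subtype.val (dif_neg hN)
  rw [this, integral_smul_measure, integral_finset_sum_measure (fun i _ => f.integrable _)]
  simp [integral_dirac' _ _ f.continuous.stronglyMeasurable]

lemma cluster_of_close (d : ℕ) (p q : Xi d)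
    (h : ∀ f : BoundedContinuousFunction (Xi d) ℝ,
      Tendsto (fun k => f ((magnify d)^[k] q) - f ((magnify d)^[k] p)) atTop (𝓝 0))
    (Q : ProbabilityMeasure (Xi d)) (hQ : MapClusterPt Q atTop (cpScenery d p)) :
    MapClusterPt Q atTop (cpScenery d q) := by
  rw [mapClusterPt_iff_ultrafilter] at hQ ⊢
  obtain ⟨U, hU, hT⟩ := hQ
  refine ⟨U, hU, ?_⟩
  rw [ProbabilityMeasure.tendsto_iff_forall_integral_tendsto] at hT ⊢
  intro f
  have h1 := ((h f).cesaro).mono_left hU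
  have h2 := h1.add (hT f)
  rw [zero_add] at h2
  refine h2.congr' ?_
  filter_upwards [hU (eventually_ne_atTop 0)] with N hN
  rw [integral_cpScenery d p N hN, integral_cpScenery d q N hN, Finset.sum_sub_distrib]
  ring

lemma close_of_density (d : ℕ) (μ : Measure (UnitCube d)) [IsFiniteMeasure μ]
    (A : Set (UnitCube d)) (hA : MeasurableSet A) (x : UnitCube d)
    (h : ∀ k, μ (dyCube d k x ∩ A) ≠ 0)
    (ht : Tendsto (fun k => μ.real (dyCube d k x ∩ A) / μ.real (dyCube d k x)) atTop (𝓝 1))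
    (f : BoundedContinuousFunction (Xi d) ℝ) :
    Tendsto (fun k => f ((magnify d)^[k] (normPM d μ, x)) -
      f ((magnify d)^[k] (normPM d (μ.restrict A), x))) atTop (𝓝 0) := by
  rw [tendsto_iff_ultrafilter]
  intro U hU
  set p := fun k => (magnify d)^[k] (normPM d μ, x) with hp
  set q := fun k => (magnify d)^[k] (normPM d (μ.restrict A), x) with hq
  obtain ⟨⟨P, y⟩, -, hPy⟩ := isCompact_univ.ultrafilter_le_nhds (U.map p) (by simp)
  have hPy' : Tendsto p U (𝓝 (P, y)) := hPy
  have hq2 : ∀ k, (q k).2 = (p k).2 := by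
    intro k
    rw [hp, hq]
    simp only
    rw [(magnify_iter d μ x (fun k hk =>
        h k (measure_mono_null Set.inter_subset_left hk)) k).2,
      (magnify_iter d (μ.restrict A) x (fun k => by
        rw [Measure.restrict_apply (measurableSet_dyCube d k x)]; exact h k) k).2]
  have hq1 : Tendsto (fun k => (q k).1) U (𝓝 P) := by
    rw [ProbabilityMeasure.tendsto_iff_forall_integral_tendsto]
    intro g
    have h1 := (ProbabilityMeasure.tendsto_iff_forall_integral_tendsto.1
      ((continuous_fst.tendsto _).comp hPy')) g
    have h2 : Tendsto (fun k => ∫ y, g y ∂((p k).1 : Measure (UnitCube d))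
        - ∫ y, g y ∂((q k).1 : Measure (UnitCube d))) U (𝓝 0) := by
      apply squeeze_zero_norm (fun k => integral_close d μ A hA x h k g)
      have := ((tendsto_const_nhds (x := (1:ℝ))).sub ht).const_mul (2 * ‖g‖)
      simp only [sub_self, mul_zero] at this
      exact this.mono_left hU
    have h3 := h1.sub h2
    simpa using h3
  have hqt : Tendsto q U (𝓝 (P, y)) := by
    refine Tendsto.prodMk_nhds hq1 ?_ |>.congr fun k => rfl
    exact ((continuous_snd.tendsto _).comp hPy').congr fun k => (hq2 k).symm
  have := ((f.continuous.tendsto _).comp hPy').sub ((f.continuous.tendsto _).comp hqt)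
  simpa using this

/-- If `μ(A) > 0`, then for `μ`-almost all `x ∈ A` the micromeasure distributions of
`μ` at `x` coincide with those of the normalized restriction `μ_A` at `x`. -/
theorem MD_restriction (d : ℕ) (μ : Measure (UnitCube d)) [IsFiniteMeasure μ]
    (A : Set (UnitCube d)) (hA : MeasurableSet A) (hpos : 0 < μ A) :
    ∀ᵐ x ∂(μ.restrict A), MD d μ x = MD d (μ.restrict A) x := by
  filter_upwards [ae_density d μ A hA] with x ⟨h, ht⟩
  have hc := close_of_density d μ A hA x h ht
  ext Q
  refine ⟨cluster_of_close d _ _ (fun f => ?_) Q, cluster_of_close d _ _ hc Q⟩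
  have := (hc f).neg
  simpa using this
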